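/- arXiv:1603.06307 — 2 statements merged into one kernel-verified Lean document; each statement's English description precedes it below -/
import Mathlib

section
/- For every positive integer n, arctan(φ^(4n-3)) = arctan(1) + (1/2)·arctan(1/2) + arctan(F_{2n-2} / F_{2n-1}). -/
open Real Finset

/-- The Lucas numbers: `L 0 = 2`, `L 1 = 1`, `L (n+2) = L (n+1) + L n`. -/
def lucas : ℕ → ℕ
  | 0 => 2
  | 1 => 1
  | n + 2 => lucas (n + 1) + lucas n

/-- The golden ratio `φ = (1 + √5)/2`. -/
noncomputable def phi : ℝ := (1 + Real.sqrt 5) / 2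

theorem phi_eq_goldenRatio : phi = Real.goldenRatio := rfl

theorem arctan_goldenRatio :
    Real.arctan Real.goldenRatio = Real.arctan 1 + (1 / 2) * Real.arctan (1 / 2) := by
  have h := Real.two_mul_arctan_add_pi Real.one_lt_goldenRatio
  have htan : 2 * Real.goldenRatio / (1 - Real.goldenRatio ^ 2) = -2 := by
    rw [Real.goldenRatio_sq, sub_add_cancel_right, div_neg,
      mul_div_cancel_right₀ _ Real.goldenRatio_ne_zero]
  have hinv : Real.arctan (1 / 2) = Real.pi / 2 - Real.arctan 2 := by
    rw [one_div, Real.arctan_inv_of_pos two_pos]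
  rw [htan, Real.arctan_neg] at h
  rw [Real.arctan_one, hinv]
  linarith

theorem arctan_goldenRatio_pow (m : ℕ) :
    Real.arctan (Real.goldenRatio ^ (4 * m + 1)) =
      Real.arctan Real.goldenRatio
        + Real.arctan ((Nat.fib (2 * m) : ℝ) / (Nat.fib (2 * m + 1) : ℝ)) := by
  have hb : (0 : ℝ) < Nat.fib (2 * m + 1) := by
    exact_mod_cast Nat.fib_pos.2 (Nat.succ_pos _)
  have hsub := Real.fib_succ_sub_goldenRatio_mul_fib (2 * m)
  have hadd := Real.goldenRatio_mul_fib_succ_add_fib (2 * m)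
  have hpos : 0 < Real.goldenConj ^ (2 * m) :=
    (even_two_mul m).pow_pos Real.goldenConj_ne_zero
  have hmul : Real.goldenRatio ^ (2 * m) * Real.goldenConj ^ (2 * m) = 1 := by
    rw [← mul_pow, Real.goldenRatio_mul_goldenConj, (even_two_mul m).neg_one_pow]
  have hlt : Real.goldenRatio * ((Nat.fib (2 * m) : ℝ) / (Nat.fib (2 * m + 1) : ℝ)) < 1 := by
    rw [← mul_div_assoc, div_lt_one hb]
    linarith
  rw [Real.arctan_add hlt]
  congr 1
  rw [eq_div_iff (by linarith)]
  calc Real.goldenRatio ^ (4 * m + 1) *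
        (1 - Real.goldenRatio * ((Nat.fib (2 * m) : ℝ) / (Nat.fib (2 * m + 1) : ℝ)))
      = Real.goldenRatio ^ (4 * m + 1) * Real.goldenConj ^ (2 * m)
          / (Nat.fib (2 * m + 1) : ℝ) := by
        rw [← hsub]
        field_simp
    _ = Real.goldenRatio ^ (2 * m + 1)
          * (Real.goldenRatio ^ (2 * m) * Real.goldenConj ^ (2 * m))
          / (Nat.fib (2 * m + 1) : ℝ) := by ring
    _ = Real.goldenRatio + (Nat.fib (2 * m) : ℝ) / (Nat.fib (2 * m + 1) : ℝ) := by
        rw [hmul, mul_one, ← hadd]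
        field_simp

theorem stmt8 (n : ℕ) (hn : 1 ≤ n) :
    Real.arctan (phi ^ (4 * n - 3)) =
      Real.arctan 1 + (1 / 2) * Real.arctan (1 / 2)
        + Real.arctan ((Nat.fib (2 * n - 2) : ℝ) / (Nat.fib (2 * n - 1) : ℝ)) := by
  obtain ⟨m, rfl⟩ := Nat.exists_eq_add_of_le' hn
  rw [← arctan_goldenRatio, phi_eq_goldenRatio, show 4 * (m + 1) - 3 = 4 * m + 1 by omega,
    show 2 * (m + 1) - 2 = 2 * m by omega, show 2 * (m + 1) - 1 = 2 * m + 1 by omega]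
  exact arctan_goldenRatio_pow m
end

section
/- For every positive integer n, arctan(2 / L_{2n+1}) = arctan(1 / F_{2n}) − arctan(1 / L_{2n}). -/
open Real Finset

theorem lucas_add_fib (m : ℕ) : lucas m + Nat.fib m = 2 * Nat.fib (m + 1) := by
  induction m using Nat.twoStepInduction with
  | zero => simp [lucas]
  | one => simp [lucas]
  | more k ih₁ ih₂ =>
    have h₁ := Nat.fib_add_two (n := k)
    have h₂ := Nat.fib_add_two (n := k + 1)
    simp only [lucas]
    grind

/-- Cassini's identity at even indices, written with two consecutive Fibonacci numbers. -/
theorem fib_two_mul_cassini (n : ℕ) :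
    Nat.fib (2 * n + 1) ^ 2 =
      Nat.fib (2 * n) * Nat.fib (2 * n + 1) + Nat.fib (2 * n) ^ 2 + 1 := by
  induction n with
  | zero => simp
  | succ k ih =>
    have h₁ := Nat.fib_add_two (n := 2 * k)
    have h₂ := Nat.fib_add_two (n := 2 * k + 1)
    rw [show 2 * (k + 1) = 2 * k + 2 by ring, h₂, h₁]
    linarith

theorem stmt15 (n : ℕ) (hn : 1 ≤ n) :
    Real.arctan (2 / (lucas (2 * n + 1) : ℝ)) =
      Real.arctan (1 / (Nat.fib (2 * n) : ℝ)) - Real.arctan (1 / (lucas (2 * n) : ℝ)) := by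
  have hF : (0 : ℝ) < Nat.fib (2 * n) := by
    exact_mod_cast Nat.fib_pos.2 (by omega)
  have hF' : (Nat.fib (2 * n) : ℝ) ≤ Nat.fib (2 * n + 1) := by
    exact_mod_cast Nat.fib_le_fib_succ
  have hC : (Nat.fib (2 * n + 1) : ℝ) ^ 2 =
      Nat.fib (2 * n) * Nat.fib (2 * n + 1) + (Nat.fib (2 * n) : ℝ) ^ 2 + 1 := by
    exact_mod_cast fib_two_mul_cassini n
  have hL : (lucas (2 * n) : ℝ) = 2 * Nat.fib (2 * n + 1) - Nat.fib (2 * n) := by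
    rw [eq_sub_iff_add_eq]
    exact_mod_cast lucas_add_fib (2 * n)
  have hL' : (lucas (2 * n + 1) : ℝ) = 2 * Nat.fib (2 * n) + Nat.fib (2 * n + 1) := by
    have h := lucas_add_fib (2 * n + 1)
    rw [Nat.fib_add_two] at h
    exact_mod_cast (by linarith :
      lucas (2 * n + 1) = 2 * Nat.fib (2 * n) + Nat.fib (2 * n + 1))
  rw [hL, hL']
  generalize (Nat.fib (2 * n) : ℝ) = a at *
  generalize (Nat.fib (2 * n + 1) : ℝ) = b at *
  have hb : 0 < 2 * b - a := by linarith
  have hab : 0 < 2 * a + b := by linarith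
  have hprod : 0 < a * (2 * b - a) := mul_pos hF hb
  have hlt : 1 / a * -(1 / (2 * b - a)) < 1 := by
    have : 0 < 1 / a * (1 / (2 * b - a)) := by positivity
    linarith
  rw [sub_eq_add_neg, ← Real.arctan_neg, Real.arctan_add hlt]
  congr 1
  have hnum : 1 / a + -(1 / (2 * b - a)) = (2 * b - 2 * a) / (a * (2 * b - a)) := by
    field_simp
    ring
  have hden : 1 - 1 / a * -(1 / (2 * b - a)) = (a * (2 * b - a) + 1) / (a * (2 * b - a)) := by
    field_simp
    ring
  rw [hnum, hden, div_div_div_cancel_right₀ hprod.ne', div_eq_div_iff hab.ne' (by positivity)]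
  linear_combination -2 * hC
end
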